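/- Let p be a prime, N ∈ ℕ, let H_{p,N} be the point set consisting of the first N elements of the Halton sequence H_p in base p (i.e., the van der Corput sequence), and let m ∈ ℕ be minimal such that N < p^m. Then for every σ_m ∈ ℚ(p^m) and every weight 0 < γ_1 ≤ 1, e²_{N,1}(H_{p,N} ⊕_{p,m}^{simi} σ_m) ≤ p^m ∫_0^{p^{−m}} e²_{N,1}(H_{p,N} ⊕_p (σ_m + δ)) dδ. -/

import Mathlib

open MeasureTheory Finset

/-- The digit of `x ∈ [0,1)` at base-`p` position `r` (the coefficient of `p^{-(r+1)}`),
using the finite expansion for `p`-adic rationals. -/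
noncomputable def rdigit (p : ℕ) (x : ℝ) (r : ℕ) : ℕ :=
  (⌊x * (p : ℝ) ^ (r + 1)⌋).toNat % p

/-- The value of the `p`-adic integer `φ_p^+(x)` modulo `p^m`, as a natural number. -/
noncomputable def truncVal (p : ℕ) (x : ℝ) (m : ℕ) : ℕ :=
  ∑ r ∈ Finset.range m, rdigit p x r * p ^ r

/-- Digit `r` of the `p`-adic sum `φ_p^+(x) +_{ℤ_p} φ_p^+(σ)`. -/
noncomputable def sdigit (p : ℕ) (x σ : ℝ) (r : ℕ) : ℕ :=
  (truncVal p x (r + 1) + truncVal p σ (r + 1)) % p ^ (r + 1) / p ^ r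

/-- The `p`-adic shift `x ⊕_p σ = φ_p(φ_p^+(x) +_{ℤ_p} φ_p^+(σ))` (the Monna map applied to
the `p`-adic sum, taken mod 1). -/
noncomputable def pshift (p : ℕ) (x σ : ℝ) : ℝ :=
  Int.fract (∑' r : ℕ, (sdigit p x σ r : ℝ) / (p : ℝ) ^ (r + 1))

/-- The simplified `p`-adic shift `x ⊕_{p,m}^{simp} σ`: the truncation of `x ⊕_p σ` to its `m`
most significant base-`p` digits. -/
noncomputable def simpShift (p m : ℕ) (x σ : ℝ) : ℝ :=
  ∑ r ∈ Finset.range m, (sdigit p x σ r : ℝ) / (p : ℝ) ^ (r + 1)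

/-- The mid-simplified `p`-adic shift `x ⊕_{p,m}^{simi} σ = (x ⊕_{p,m}^{simp} σ) + 1/(2p^m)`. -/
noncomputable def midShift (p m : ℕ) (x σ : ℝ) : ℝ :=
  simpShift p m x σ + 1 / (2 * (p : ℝ) ^ m)

/-- The radical inverse function `φ_p(n) = Σ_r n_r p^{-(r+1)}` in base `p`. -/
noncomputable def radInv (p n : ℕ) : ℝ :=
  ∑' r : ℕ, ((n / p ^ r % p : ℕ) : ℝ) / (p : ℝ) ^ (r + 1)

/-- Membership in `ℚ(p^m) = {a p^{-m} : a = 0,1,…,p^m - 1}`. -/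
def QSet (p m : ℕ) (x : ℝ) : Prop :=
  ∃ a : ℕ, a < p ^ m ∧ x = (a : ℝ) / (p : ℝ) ^ m

/-- The squared worst-case error of the QMC rule based on the `N`-element point set
`P ⊆ [0,1)^d` in the weighted anchored Sobolev space with weights `γ` (0-indexed, so the
paper's `γ_j` is `γ (j-1)`). -/
noncomputable def sqErr (d N : ℕ) (γ : ℕ → ℝ) (P : Fin N → Fin d → ℝ) : ℝ :=
  (∏ j : Fin d, (1 + γ j.val / 3))
    - 2 / (N : ℝ) * ∑ n : Fin N, ∏ j : Fin d, (1 + γ j.val / 2 * (1 - P n j ^ 2))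
    + 1 / (N : ℝ) ^ 2 *
        ∑ n : Fin N, ∑ h : Fin N, ∏ j : Fin d, (1 + γ j.val * min (1 - P n j) (1 - P h j))

/-- The real number in `[0,1]` with base-`p` digits `f`. -/
noncomputable def digitSum (p : ℕ) (f : ℕ → ℕ) : ℝ :=
  ∑' r : ℕ, (f r : ℝ) / (p : ℝ) ^ (r + 1)

lemma hasSum_max_digits {p : ℕ} (hp : 2 ≤ p) :
    HasSum (fun r : ℕ => ((p : ℝ) - 1) / (p : ℝ) ^ (r + 1)) 1 := by
  have hp' : (2 : ℝ) ≤ p := by exact_mod_cast hp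
  have h := (hasSum_geometric_of_lt_one (r := (p : ℝ)⁻¹) (by positivity)
    (inv_lt_one_of_one_lt₀ (by linarith))).mul_left (((p : ℝ) - 1) / p)
  have hne : (p : ℝ) - 1 ≠ 0 := by linarith
  have hval : ((p : ℝ) - 1) / p * (1 - (p : ℝ)⁻¹)⁻¹ = 1 := by
    have hp0 : (p : ℝ) ≠ 0 := by linarith
    have h1 : 1 - (p : ℝ)⁻¹ = (p - 1) / p := by field_simp
    rw [h1, mul_inv_cancel₀ (div_ne_zero hne hp0)]
  have hfun : (fun r : ℕ => ((p : ℝ) - 1) / (p : ℝ) ^ (r + 1))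
      = fun r => ((p : ℝ) - 1) / p * (p : ℝ)⁻¹ ^ r := by
    funext r
    rw [inv_pow, pow_succ]
    field_simp
  rw [hfun]
  rwa [hval] at h

lemma digit_div_le {p : ℕ} {f : ℕ → ℕ} (hf : ∀ r, f r < p) (r : ℕ) :
    (f r : ℝ) / (p : ℝ) ^ (r + 1) ≤ ((p : ℝ) - 1) / (p : ℝ) ^ (r + 1) := by
  have h : ((f r + 1 : ℕ) : ℝ) ≤ p := by exact_mod_cast hf r
  push_cast at h
  gcongr
  linarith

lemma summable_digits {p : ℕ} (hp : 2 ≤ p) {f : ℕ → ℕ} (hf : ∀ r, f r < p) :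
    Summable fun r : ℕ => (f r : ℝ) / (p : ℝ) ^ (r + 1) :=
  Summable.of_nonneg_of_le (fun r => by positivity) (digit_div_le hf)
    (hasSum_max_digits hp).summable

lemma digitSum_nonneg (p : ℕ) (f : ℕ → ℕ) : 0 ≤ digitSum p f :=
  tsum_nonneg fun r => by positivity

lemma digitSum_le_one {p : ℕ} (hp : 2 ≤ p) {f : ℕ → ℕ} (hf : ∀ r, f r < p) :
    digitSum p f ≤ 1 :=
  (Summable.tsum_le_tsum (digit_div_le hf) (summable_digits hp hf)
    (hasSum_max_digits hp).summable).trans_eq (hasSum_max_digits hp).tsum_eq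

lemma digitSum_eq_sum_add {p : ℕ} (hp : 2 ≤ p) {f : ℕ → ℕ} (hf : ∀ r, f r < p) (m : ℕ) :
    digitSum p f = ∑ r ∈ range m, (f r : ℝ) / (p : ℝ) ^ (r + 1)
      + digitSum p (fun r => f (m + r)) / (p : ℝ) ^ m := by
  have hp' : (p : ℝ) ≠ 0 := by positivity
  unfold digitSum
  rw [← (summable_digits hp hf).sum_add_tsum_nat_add m, ← tsum_div_const]
  congr 1
  refine tsum_congr fun r => ?_
  rw [add_comm r m, add_assoc, pow_add, div_div, mul_comm]

lemma digitSum_succ {p : ℕ} (hp : 2 ≤ p) {f : ℕ → ℕ} (hf : ∀ r, f r < p) :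
    digitSum p f = (f 0 + digitSum p (fun r => f (r + 1))) / p := by
  rw [digitSum_eq_sum_add hp hf 1]
  simp [add_comm 1, add_div]

lemma rdigit_cons_zero {p e : ℕ} (he : e < p) {z : ℝ} (hz0 : 0 ≤ z) (hz1 : z < 1) :
    rdigit p ((e + z) / p) 0 = e := by
  have hp' : (p : ℝ) ≠ 0 := by
    have : 0 < p := by omega
    positivity
  have h : ((e : ℝ) + z) / p * (p : ℝ) ^ (0 + 1) = e + z := by field_simp; simp
  rw [rdigit, h, Int.floor_toNat, add_comm, Nat.floor_add_natCast hz0, Nat.floor_eq_zero.2 hz1, zero_add,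
    Nat.mod_eq_of_lt he]

lemma rdigit_cons_succ {p : ℕ} (hp : 2 ≤ p) (e : ℕ) {z : ℝ} (hz0 : 0 ≤ z) (r : ℕ) :
    rdigit p ((e + z) / p) (r + 1) = rdigit p z r := by
  have hp' : (p : ℝ) ≠ 0 := by positivity
  have h : ((e : ℝ) + z) / p * (p : ℝ) ^ (r + 1 + 1)
      = ((p * (e * p ^ r) : ℕ) : ℝ) + z * (p : ℝ) ^ (r + 1) := by
    push_cast; field_simp; ring
  rw [rdigit, rdigit, h, Int.floor_toNat, Int.floor_toNat,
    add_comm, Nat.floor_add_natCast (by positivity), Nat.add_mul_mod_self_left]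

lemma truncVal_cons {p e : ℕ} (hp : 2 ≤ p) (he : e < p) {z : ℝ} (hz0 : 0 ≤ z) (hz1 : z < 1)
    (r : ℕ) : truncVal p ((e + z) / p) (r + 1) = e + p * truncVal p z r := by
  unfold truncVal
  rw [sum_range_succ', rdigit_cons_zero he hz0 hz1, mul_sum, add_comm]
  congr 1
  · simp
  · refine sum_congr rfl fun i _ => ?_
    rw [rdigit_cons_succ hp e hz0]
    ring

lemma truncVal_mod {p : ℕ} (hp : 2 ≤ p) (x : ℝ) {k r : ℕ} (h : k ≤ r) :
    truncVal p x r % p ^ k = truncVal p x k := by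
  have hlt : ∀ k, truncVal p x k < p ^ k := by
    intro k
    induction k with
    | zero => simp [truncVal]
    | succ k ih =>
      have hd : rdigit p x k + 1 ≤ p := Nat.mod_lt _ (by omega)
      have := Nat.mul_le_mul_right (p ^ k) hd
      rw [truncVal, sum_range_succ, pow_succ']
      rw [truncVal] at ih
      linarith
  induction r, h using Nat.le_induction with
  | base => exact Nat.mod_eq_of_lt (hlt k)
  | succ r hr ih =>
    rw [truncVal, sum_range_succ, ← truncVal, ← ih]
    obtain ⟨j, rfl⟩ := Nat.exists_eq_add_of_le hr
    rw [pow_add, mul_left_comm, Nat.add_mul_mod_self_left]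

lemma radInv_cons {p : ℕ} (hp : 2 ≤ p) (n : ℕ) :
    radInv p n = ((n % p : ℕ) + radInv p (n / p)) / p := by
  have h := digitSum_succ hp (f := fun r => n / p ^ r % p) (fun r => Nat.mod_lt _ (by omega))
  simp only [pow_zero, Nat.div_one, pow_succ', ← Nat.div_div_eq_div_mul] at h
  exact h

lemma radInv_nonneg (p n : ℕ) : 0 ≤ radInv p n := digitSum_nonneg _ _

lemma radInv_lt_one {p : ℕ} (hp : 2 ≤ p) (n : ℕ) : radInv p n < 1 := by
  induction n using Nat.strong_induction_on with
  | _ n ih =>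
    rcases Nat.eq_zero_or_pos n with rfl | hn
    · simp [radInv]
    · have h1 := ih (n / p) (Nat.div_lt_self hn (by omega))
      have h2 : ((n % p + 1 : ℕ) : ℝ) ≤ p := by exact_mod_cast Nat.mod_lt n (by omega)
      rw [radInv_cons hp, div_lt_one (by positivity)]
      push_cast at h2 ⊢
      linarith

lemma truncVal_radInv {p : ℕ} (hp : 2 ≤ p) (n r : ℕ) :
    truncVal p (radInv p n) r = n % p ^ r := by
  induction r generalizing n with
  | zero => simp [truncVal, Nat.mod_one]
  | succ r ih =>
    rw [radInv_cons hp, truncVal_cons hp (Nat.mod_lt _ (by omega)) (radInv_nonneg _ _)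
      (radInv_lt_one hp _), ih, pow_succ', Nat.mod_mul]

lemma exists_truncVal_add {p : ℕ} (hp : 2 ≤ p) (m a : ℕ) (ha : a < p ^ m) :
    ∃ s < p ^ m, ∀ z : ℝ, 0 ≤ z → z < 1 → ∀ k,
      truncVal p ((a + z) / (p : ℝ) ^ m) (m + k) = s + p ^ m * truncVal p z k := by
  have hp' : (0 : ℝ) < p := by positivity
  induction m generalizing a with
  | zero =>
    refine ⟨0, by simp, fun z _ _ k => ?_⟩
    have : a = 0 := by simpa using ha
    simp [this]
  | succ m ih =>
    have hpos : 0 < p ^ m := by positivity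
    obtain ⟨s, hs, h⟩ := ih (a % p ^ m) (Nat.mod_lt _ hpos)
    have he : a / p ^ m < p := Nat.div_lt_of_lt_mul (by rwa [pow_succ] at ha)
    refine ⟨a / p ^ m + p * s, ?_, fun z hz0 hz1 k => ?_⟩
    · have := Nat.mul_le_mul_left p (Nat.succ_le_of_lt hs)
      rw [pow_succ']
      simp only [Nat.succ_eq_add_one] at this
      linarith
    · have hsplit : ((a : ℝ) + z) / (p : ℝ) ^ (m + 1)
          = ((a / p ^ m : ℕ) + (((a % p ^ m : ℕ) : ℝ) + z) / (p : ℝ) ^ m) / p := by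
        have hd : (a : ℝ) = (p : ℝ) ^ m * (a / p ^ m : ℕ) + (a % p ^ m : ℕ) := by
          exact_mod_cast (Nat.div_add_mod a (p ^ m)).symm
        nth_rewrite 1 [hd]
        rw [pow_succ]
        field_simp
        ring
      have hlt : (((a % p ^ m : ℕ) : ℝ) + z) / (p : ℝ) ^ m < 1 := by
        have : ((a % p ^ m + 1 : ℕ) : ℝ) ≤ (p : ℝ) ^ m := by
          exact_mod_cast Nat.mod_lt a hpos
        rw [div_lt_one (by positivity)]
        push_cast at this ⊢
        linarith
      rw [hsplit, add_right_comm, truncVal_cons hp he (by positivity) hlt, h z hz0 hz1]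
      ring

/-- The digits of `c + φ_p^+(z)`. -/
noncomputable def addDigit (p c : ℕ) (z : ℝ) (r : ℕ) : ℕ :=
  (c + truncVal p z (r + 1)) / p ^ r % p

/-- The value `φ_p(c + φ_p^+(z))`, before reduction mod 1. -/
noncomputable def addShift (p c : ℕ) (z : ℝ) : ℝ := digitSum p (addDigit p c z)

lemma addDigit_lt {p : ℕ} (hp : 2 ≤ p) (c : ℕ) (z : ℝ) (r : ℕ) : addDigit p c z r < p :=
  Nat.mod_lt _ (by omega)

lemma addShift_nonneg (p c : ℕ) (z : ℝ) : 0 ≤ addShift p c z := digitSum_nonneg _ _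

lemma addShift_le_one {p : ℕ} (hp : 2 ≤ p) (c : ℕ) (z : ℝ) : addShift p c z ≤ 1 :=
  digitSum_le_one hp (addDigit_lt hp c z)

lemma addShift_cons {p e : ℕ} (hp : 2 ≤ p) (he : e < p) (c : ℕ) {z : ℝ} (hz0 : 0 ≤ z)
    (hz1 : z < 1) :
    addShift p c ((e + z) / p) = (((c + e) % p : ℕ) + addShift p ((c + e) / p) z) / p := by
  have h0 : addDigit p c ((e + z) / p) 0 = (c + e) % p := by
    rw [addDigit, truncVal_cons hp he hz0 hz1, pow_zero, Nat.div_one, ← add_assoc,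
      Nat.add_mul_mod_self_left]
  have h1 : (fun r => addDigit p c ((e + z) / p) (r + 1)) = addDigit p ((c + e) / p) z := by
    funext r
    rw [addDigit, addDigit, truncVal_cons hp he hz0 hz1, pow_succ', ← Nat.div_div_eq_div_mul,
      ← add_assoc, Nat.add_mul_div_left _ _ (by omega)]
  rw [addShift, digitSum_succ hp (addDigit_lt hp _ _), h0, h1, addShift]

lemma exists_cons {p : ℕ} (hp : 2 ≤ p) {z : ℝ} (hz0 : 0 ≤ z) (hz1 : z < 1) :
    ∃ e < p, ∃ y : ℝ, 0 ≤ y ∧ y < 1 ∧ z = (e + y) / p := by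
  have hp' : (0 : ℝ) < p := by positivity
  refine ⟨⌊(p : ℝ) * z⌋₊, ?_, (p : ℝ) * z - ⌊(p : ℝ) * z⌋₊, ?_, ?_, ?_⟩
  · rw [Nat.floor_lt (by positivity)]
    nlinarith
  · linarith [Nat.floor_le (a := (p : ℝ) * z) (by positivity)]
  · linarith [Nat.lt_floor_add_one ((p : ℝ) * z)]
  · field_simp
    ring

lemma addShift_zero {p : ℕ} (hp : 2 ≤ p) {z : ℝ} (hz0 : 0 ≤ z) (hz1 : z < 1) :
    addShift p 0 z = z := by
  have hp' : (2 : ℝ) ≤ p := by exact_mod_cast hp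
  have key : ∀ k : ℕ, ∀ z : ℝ, 0 ≤ z → z < 1 → |addShift p 0 z - z| ≤ ((p : ℝ)⁻¹) ^ k := by
    intro k
    induction k with
    | zero =>
      intro z hz0 hz1
      rw [pow_zero, abs_le]
      constructor <;> linarith [addShift_nonneg p 0 z, addShift_le_one hp 0 z]
    | succ k ih =>
      intro z hz0 hz1
      obtain ⟨e, he, y, hy0, hy1, rfl⟩ := exists_cons hp hz0 hz1
      have := ih y hy0 hy1
      rw [addShift_cons hp he 0 hy0 hy1, zero_add, Nat.mod_eq_of_lt he, Nat.div_eq_of_lt he,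
        ← sub_div, add_sub_add_left_eq_sub, abs_div, abs_of_pos (by linarith : (0 : ℝ) < p),
        pow_succ, ← div_eq_mul_inv]
      gcongr
  have hlim := tendsto_pow_atTop_nhds_zero_of_lt_one (r := (p : ℝ)⁻¹) (by positivity)
    (inv_lt_one_of_one_lt₀ (by linarith))
  have := ge_of_tendsto' hlim (fun k => key k z hz0 hz1)
  exact sub_eq_zero.1 (abs_nonpos_iff.1 this)

lemma addShift_one_of_lt {p : ℕ} (hp : 2 ≤ p) {z : ℝ} (hz0 : 0 ≤ z)
    (hz1 : z < 1 - (p : ℝ)⁻¹) : addShift p 1 z = z + (p : ℝ)⁻¹ := by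
  have hp' : (0 : ℝ) < p := by positivity
  have hinv : 0 < (p : ℝ)⁻¹ := by positivity
  obtain ⟨e, he, y, hy0, hy1, rfl⟩ := exists_cons hp hz0 (by linarith : z < 1)
  have he' : 1 + e < p := by
    rw [div_lt_iff₀ hp', sub_mul, inv_mul_cancel₀ hp'.ne'] at hz1
    have : ((1 + e : ℕ) : ℝ) < p := by push_cast; linarith
    exact_mod_cast this
  rw [addShift_cons hp he 1 hy0 hy1, Nat.mod_eq_of_lt he', Nat.div_eq_of_lt he',
    addShift_zero hp hy0 hy1]
  push_cast
  field_simp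
  ring

lemma addShift_one_last {p : ℕ} (hp : 2 ≤ p) {y : ℝ} (hy0 : 0 ≤ y) (hy1 : y < 1) :
    addShift p 1 (((p : ℝ) - 1 + y) / p) = addShift p 1 y / p := by
  have h := addShift_cons hp (show p - 1 < p by omega) 1 hy0 hy1
  rw [show 1 + (p - 1) = p by omega, Nat.mod_self, Nat.div_self (by omega),
    Nat.cast_sub (by omega)] at h
  simpa using h

lemma addShift_lt_one {p : ℕ} (hp : 2 ≤ p) {c : ℕ} (hc : c ≤ 1) {z : ℝ} (hz0 : 0 ≤ z)
    (hz1 : z < 1) : addShift p c z < 1 := by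
  have hp' : (2 : ℝ) ≤ p := by exact_mod_cast hp
  interval_cases c
  · rwa [addShift_zero hp hz0 hz1]
  · rcases lt_or_ge z (1 - (p : ℝ)⁻¹) with h | h
    · rw [addShift_one_of_lt hp hz0 h]
      linarith
    · have hz : z = ((p : ℝ) - 1 + (p * z - (p - 1))) / p := by field_simp; ring
      have h' : (p : ℝ) * (1 - (p : ℝ)⁻¹) = p - 1 := by field_simp
      rw [hz, addShift_one_last hp (by nlinarith) (by nlinarith), div_lt_one (by linarith)]
      linarith [addShift_le_one hp 1 (p * z - (p - 1))]

lemma measurable_addShift {p : ℕ} (hp : 2 ≤ p) (c : ℕ) : Measurable (addShift p c) := by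
  have hdig : ∀ r, Measurable fun z => rdigit p z r := fun r =>
    (measurable_from_top (f := fun k : ℤ => k.toNat % p)).comp
      (Int.measurable_floor.comp (measurable_id.mul_const _))
  have htr : ∀ k, Measurable fun z => truncVal p z k := fun k =>
    Finset.measurable_fun_sum _ fun r _ => (hdig r).mul_const _
  have hterm : ∀ r, Measurable fun z => (addDigit p c z r : ℝ) / (p : ℝ) ^ (r + 1) := fun r =>
    (measurable_from_top (f := fun k : ℕ => (((c + k) / p ^ r % p : ℕ) : ℝ) /
      (p : ℝ) ^ (r + 1))).comp (htr (r + 1))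
  refine measurable_of_tendsto_metrizable
    (f := fun k z => ∑ r ∈ range k, (addDigit p c z r : ℝ) / (p : ℝ) ^ (r + 1))
    (fun k => Finset.measurable_fun_sum _ fun r _ => hterm r) ?_
  rw [tendsto_pi_nhds]
  exact fun z => (summable_digits hp (addDigit_lt hp c z)).hasSum.tendsto_sum_nat

lemma intervalIntegrable_addShift {p : ℕ} (hp : 2 ≤ p) (c : ℕ) (a b : ℝ) :
    IntervalIntegrable (addShift p c) volume a b := by
  refine (intervalIntegrable_const (c := (1 : ℝ))).mono_fun
    (measurable_addShift hp c).aestronglyMeasurable (Filter.Eventually.of_forall fun z => ?_)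
  beta_reduce
  rw [Real.norm_of_nonneg (addShift_nonneg _ _ _), norm_one]
  exact addShift_le_one hp c z

lemma ae_ne_right (b : ℝ) : ∀ᵐ x : ℝ, x ≠ b := by simp [ae_iff]

lemma integral_addShift {p : ℕ} (hp : 2 ≤ p) {c : ℕ} (hc : c ≤ 1) :
    ∫ z in (0 : ℝ)..1, addShift p c z = 1 / 2 := by
  have hp' : (2 : ℝ) ≤ p := by exact_mod_cast hp
  have hp0 : (0 : ℝ) < p := by linarith
  interval_cases c
  · have : ∫ z in (0 : ℝ)..1, addShift p 0 z = ∫ z in (0 : ℝ)..1, z := by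
      refine intervalIntegral.integral_congr_ae ?_
      filter_upwards [ae_ne_right 1] with z hz hmem
      rw [Set.uIoc_of_le zero_le_one] at hmem
      exact addShift_zero hp hmem.1.le (lt_of_le_of_ne hmem.2 hz)
    rw [this, integral_id]
    norm_num
  · set q : ℝ := 1 - (p : ℝ)⁻¹ with hq
    have hinv : (p : ℝ)⁻¹ ≤ 1 := inv_le_one_of_one_le₀ (by linarith)
    have hq0 : 0 ≤ q := by linarith
    have h1 : ∫ z in (0 : ℝ)..q, addShift p 1 z = q ^ 2 / 2 + q * (p : ℝ)⁻¹ := by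
      have : ∫ z in (0 : ℝ)..q, addShift p 1 z = ∫ z in (0 : ℝ)..q, (z + (p : ℝ)⁻¹) := by
        refine intervalIntegral.integral_congr_ae ?_
        filter_upwards [ae_ne_right q] with z hz hmem
        rw [Set.uIoc_of_le hq0] at hmem
        exact addShift_one_of_lt hp hmem.1.le (lt_of_le_of_ne hmem.2 hz)
      rw [this, intervalIntegral.integral_add (by simp) (by simp), integral_id]
      simp
    have h2 : ∫ z in q..1, addShift p 1 z
        = (p : ℝ)⁻¹ ^ 2 * ∫ z in (0 : ℝ)..1, addShift p 1 z := by
      have hsub := intervalIntegral.integral_comp_add_div (a := 0) (b := 1) (addShift p 1)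
        hp0.ne' q
      have : ∫ z in (0 : ℝ)..1, addShift p 1 (q + z / p)
          = ∫ z in (0 : ℝ)..1, addShift p 1 z / p := by
        refine intervalIntegral.integral_congr_ae ?_
        filter_upwards [ae_ne_right 1] with z hz hmem
        rw [Set.uIoc_of_le zero_le_one] at hmem
        rw [← addShift_one_last hp hmem.1.le (lt_of_le_of_ne hmem.2 hz), hq]
        congr 1
        field_simp
      rw [this, intervalIntegral.integral_div, zero_div, add_zero, hq, one_div,
        sub_add_cancel, smul_eq_mul, ← hq] at hsub
      field_simp
      field_simp at hsub
      linarith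
    have h3 := intervalIntegral.integral_add_adjacent_intervals
      (intervalIntegrable_addShift hp 1 0 q) (intervalIntegrable_addShift hp 1 q 1)
    rw [h1, h2] at h3
    have hne : 1 - (p : ℝ)⁻¹ ^ 2 ≠ 0 := by
      have : (p : ℝ)⁻¹ < 1 := inv_lt_one_of_one_lt₀ (by linarith)
      have : 0 < (p : ℝ)⁻¹ := by positivity
      nlinarith
    apply mul_left_cancel₀ hne
    rw [hq] at h3
    linarith

/-- The reversal of the `m` least significant base-`p` digits of `k`. -/
def revDigits (p : ℕ) : ℕ → ℕ → ℕ
  | 0, _ => 0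
  | m + 1, k => p ^ m * (k % p) + revDigits p m (k / p)

lemma revDigits_lt {p : ℕ} (hp : 2 ≤ p) (m k : ℕ) : revDigits p m k < p ^ m := by
  induction m generalizing k with
  | zero => simp [revDigits]
  | succ m ih =>
    have h1 := ih (k / p)
    have h2 := Nat.mul_le_mul_left (p ^ m) (Nat.succ_le_of_lt (Nat.mod_lt k (by omega : p > 0)))
    rw [revDigits, pow_succ]
    simp only [Nat.succ_eq_add_one] at h2
    linarith

lemma mod_eq_of_revDigits_eq {p : ℕ} (hp : 2 ≤ p) (m : ℕ) {k l : ℕ}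
    (h : revDigits p m k = revDigits p m l) : k % p ^ m = l % p ^ m := by
  induction m generalizing k l with
  | zero => simp [Nat.mod_one]
  | succ m ih =>
    have hpos : 0 < p ^ m := by positivity
    rw [revDigits, revDigits] at h
    have hdiv := congrArg (· / p ^ m) h
    have hmod := congrArg (· % p ^ m) h
    simp only [Nat.mul_add_div hpos, Nat.mul_add_mod, Nat.div_eq_of_lt (revDigits_lt hp m _),
      Nat.mod_eq_of_lt (revDigits_lt hp m _), add_zero] at hdiv hmod
    rw [pow_succ', Nat.mod_mul, Nat.mod_mul, hdiv, ih hmod]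

lemma sum_digits_eq_revDigits {p : ℕ} (hp : 2 ≤ p) (m k : ℕ) :
    ∑ r ∈ range m, ((k / p ^ r % p : ℕ) : ℝ) / (p : ℝ) ^ (r + 1)
      = (revDigits p m k : ℝ) / (p : ℝ) ^ m := by
  have hp' : (p : ℝ) ≠ 0 := by positivity
  induction m generalizing k with
  | zero => simp [revDigits]
  | succ m ih =>
    have h : ∑ r ∈ range m, ((k / p ^ (r + 1) % p : ℕ) : ℝ) / (p : ℝ) ^ (r + 1 + 1)
        = (revDigits p m (k / p) : ℝ) / (p : ℝ) ^ m / p := by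
      rw [← ih, sum_div]
      refine sum_congr rfl fun r _ => ?_
      rw [pow_succ' p r, ← Nat.div_div_eq_div_mul, div_div, ← pow_succ]
    rw [sum_range_succ', h, revDigits]
    push_cast
    field_simp
    simp
    ring

lemma sdigit_radInv {p : ℕ} (hp : 2 ≤ p) (n : ℕ) (σ : ℝ) (r : ℕ) :
    sdigit p (radInv p n) σ r = (n + truncVal p σ (r + 1)) / p ^ r % p := by
  rw [sdigit, truncVal_radInv hp, Nat.mod_add_mod, pow_succ, Nat.mod_mul_right_div_self]

lemma exists_shift_formulas {p : ℕ} (hp : 2 ≤ p) {m a : ℕ} (ha : a < p ^ m) :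
    ∃ s < p ^ m, ∀ n < p ^ m,
      simpShift p m (radInv p n) (a / (p : ℝ) ^ m)
        = (revDigits p m (n + s) : ℝ) / (p : ℝ) ^ m ∧
      ∀ z : ℝ, 0 ≤ z → z < 1 → pshift p (radInv p n) ((a + z) / (p : ℝ) ^ m)
        = (revDigits p m (n + s) + addShift p ((n + s) / p ^ m) z) / (p : ℝ) ^ m := by
  have hp' : (0 : ℝ) < p := by positivity
  obtain ⟨s, hs, hval⟩ := exists_truncVal_add hp m a ha
  refine ⟨s, hs, fun n hn => ?_⟩
  have hlow : ∀ z : ℝ, 0 ≤ z → z < 1 → ∀ r < m,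
      sdigit p (radInv p n) ((a + z) / (p : ℝ) ^ m) r = (n + s) / p ^ r % p := by
    intro z hz0 hz1 r hr
    have h0 := hval z hz0 hz1 0
    rw [add_zero, show truncVal p z 0 = 0 from rfl, mul_zero, add_zero] at h0
    rw [sdigit_radInv hp, ← truncVal_mod hp _ (Nat.succ_le_of_lt hr), h0,
      ← Nat.mod_mul_right_div_self, ← Nat.mod_mul_right_div_self, ← pow_succ, Nat.add_mod_mod]
  have hsum : ∀ z : ℝ, 0 ≤ z → z < 1 →
      simpShift p m (radInv p n) ((a + z) / (p : ℝ) ^ m)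
        = (revDigits p m (n + s) : ℝ) / (p : ℝ) ^ m := by
    intro z hz0 hz1
    rw [← sum_digits_eq_revDigits hp, simpShift]
    refine sum_congr rfl fun r hr => ?_
    rw [hlow z hz0 hz1 r (mem_range.1 hr)]
  refine ⟨by simpa using hsum 0 le_rfl one_pos, fun z hz0 hz1 => ?_⟩
  have hhigh : (fun r => sdigit p (radInv p n) ((a + z) / (p : ℝ) ^ m) (m + r))
      = addDigit p ((n + s) / p ^ m) z := by
    funext r
    rw [sdigit_radInv hp, add_assoc m r 1, hval z hz0 hz1, addDigit, pow_add,
      ← Nat.div_div_eq_div_mul, ← add_assoc, Nat.add_mul_div_left _ _ (by positivity)]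
  have hlt : ∀ r, sdigit p (radInv p n) ((a + z) / (p : ℝ) ^ m) r < p := fun r => by
    rw [sdigit_radInv hp]
    exact Nat.mod_lt _ (by omega)
  have htot : ∑' r : ℕ, (sdigit p (radInv p n) ((a + z) / (p : ℝ) ^ m) r : ℝ) /
      (p : ℝ) ^ (r + 1)
      = (revDigits p m (n + s) + addShift p ((n + s) / p ^ m) z) / (p : ℝ) ^ m := by
    have h := digitSum_eq_sum_add hp hlt m
    rw [hhigh, ← simpShift, hsum z hz0 hz1, ← addShift, ← add_div] at h
    exact h
  have hc : (n + s) / p ^ m ≤ 1 :=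
    Nat.le_of_lt_succ (Nat.div_lt_of_lt_mul (by omega))
  have hA : ((revDigits p m (n + s) + 1 : ℕ) : ℝ) ≤ (p : ℝ) ^ m := by
    exact_mod_cast revDigits_lt hp m (n + s)
  push_cast at hA
  rw [pshift, htot, Int.fract_eq_self]
  refine ⟨div_nonneg (add_nonneg (by positivity) (addShift_nonneg _ _ _)) (by positivity), ?_⟩
  rw [div_lt_one (by positivity)]
  linarith [addShift_lt_one hp hc hz0 hz1]

lemma sqErr_one_perturb {N : ℕ} (hN : 1 ≤ N) (γ : ℝ) (b w : Fin N → ℝ)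
    (hb : Function.Injective b) (hw : ∀ n h, b n < b h → b n + w n ≤ b h + w h) :
    sqErr 1 N (fun _ => γ) (fun n _ => b n + w n) = sqErr 1 N (fun _ => γ) (fun n _ => b n)
      + γ / N * ∑ n, (2 * b n * w n + w n ^ 2)
      - γ / (N : ℝ) ^ 2 * ∑ n, ∑ h, w (if b n < b h then h else n) := by
  have hN' : (N : ℝ) ≠ 0 := by positivity
  have hmin : ∀ n h, min (1 - (b n + w n)) (1 - (b h + w h))
      = min (1 - b n) (1 - b h) - w (if b n < b h then h else n) := by
    intro n h
    split_ifs with hlt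
    · rw [min_eq_right (by linarith [hw n h hlt]), min_eq_right (by linarith)]
      ring
    · have hle : b h ≤ b n := not_lt.1 hlt
      have : b h + w h ≤ b n + w n := by
        rcases hle.lt_or_eq with h1 | h1
        · exact hw h n h1
        · rw [hb h1]
      rw [min_eq_left (by linarith), min_eq_left (by linarith)]
      ring
  have h1 : ∑ n, (1 + γ / 2 * (1 - (b n + w n) ^ 2))
      = ∑ n, (1 + γ / 2 * (1 - b n ^ 2)) - γ / 2 * ∑ n, (2 * b n * w n + w n ^ 2) := by
    rw [mul_sum, ← sum_sub_distrib]
    exact sum_congr rfl fun n _ => by ring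
  have h2 : ∑ n, ∑ h, (1 + γ * min (1 - (b n + w n)) (1 - (b h + w h)))
      = ∑ n, ∑ h, (1 + γ * min (1 - b n) (1 - b h))
        - γ * ∑ n, ∑ h, w (if b n < b h then h else n) := by
    simp only [mul_sum, ← sum_sub_distrib]
    exact sum_congr rfl fun n _ => sum_congr rfl fun h _ => by rw [hmin]; ring
  simp only [sqErr, Fin.prod_univ_one, h1, h2]
  field_simp
  ring

/-- Lemma 1: the squared worst-case error of the mid-simplified shifted
van der Corput point set is bounded by the average over the corresponding cell of exact
`p`-adic shifts. -/
theorem midshift_error_le_average_dim_one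
    (p : ℕ) (hp : p.Prime) (N : ℕ) (hN : 1 ≤ N)
    (m : ℕ) (hm : 0 < m) (hmN : N < p ^ m) (hmmin : ∀ k, 0 < k → N < p ^ k → m ≤ k)
    (γ₁ : ℝ) (hγpos : 0 < γ₁) (hγ1 : γ₁ ≤ 1)
    (σm : ℝ) (hσ : QSet p m σm) :
    sqErr 1 N (fun _ => γ₁) (fun n _ => midShift p m (radInv p n.val) σm) ≤
      (p : ℝ) ^ m *
        ∫ δ in Set.Ico (0 : ℝ) (((p : ℝ) ^ m)⁻¹),
          sqErr 1 N (fun _ => γ₁) fun n _ => pshift p (radInv p n.val) (σm + δ) := by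
  have hp2 : 2 ≤ p := hp.two_le
  obtain ⟨a, ha, rfl⟩ := hσ
  obtain ⟨s, hs, hform⟩ := exists_shift_formulas hp2 ha
  set q : ℝ := (p : ℝ) ^ m with hq
  have hq0 : 0 < q := by positivity
  have hn : ∀ n : Fin N, n.val < p ^ m := fun n => n.isLt.trans hmN
  set A : Fin N → ℕ := fun n => revDigits p m (n.val + s) with hA
  set c : Fin N → ℕ := fun n => (n.val + s) / p ^ m with hcdef
  have hc : ∀ n, c n ≤ 1 := fun n =>
    Nat.le_of_lt_succ (Nat.div_lt_of_lt_mul (by have := hn n; omega))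
  have hAinj : Function.Injective A := by
    intro n h hnh
    have h1 : n.val ≡ h.val [MOD p ^ m] :=
      Nat.ModEq.add_right_cancel' s (mod_eq_of_revDigits_eq hp2 m hnh)
    exact Fin.ext (h1.eq_of_lt_of_lt (hn n) (hn h))
  set b : Fin N → ℝ := fun n => (A n + 1 / 2) / q with hb
  set w : Fin N → ℝ → ℝ := fun n δ => (addShift p (c n) (q * δ) - 1 / 2) / q with hw
  have hbinj : Function.Injective b := by
    intro n h hnh
    apply hAinj
    have : (A n : ℝ) = A h := by
      simp only [hb] at hnh
      field_simp at hnh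
      linarith
    exact_mod_cast this
  have hmid : (fun (n : Fin N) (_ : Fin 1) => midShift p m (radInv p n.val) (a / q))
      = fun n _ => b n := by
    funext n _
    rw [midShift, (hform n (hn n)).1, ← hq]
    simp only [hb, hA]
    field_simp
  have hwb : ∀ n δ, ‖w n δ‖ ≤ 1 / q := by
    intro n δ
    have h0 := addShift_nonneg p (c n) (q * δ)
    have h1 := addShift_le_one hp2 (c n) (q * δ)
    simp only [hw]
    rw [norm_div, Real.norm_of_nonneg hq0.le]
    gcongr
    rw [Real.norm_eq_abs, abs_le]
    constructor <;> linarith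
  have hwm : ∀ n, Measurable (w n) := fun n =>
    (((measurable_addShift hp2 (c n)).comp (measurable_const_mul q)).sub_const _).div_const _
  set I : Set ℝ := Set.Ico (0 : ℝ) q⁻¹ with hI
  have hwi : ∀ n, Integrable (w n) (volume.restrict I) := fun n =>
    Integrable.of_bound (hwm n).aestronglyMeasurable (1 / q)
      (Filter.Eventually.of_forall (hwb n))
  have hw2i : ∀ n, Integrable (fun δ => w n δ ^ 2) (volume.restrict I) := fun n =>
    Integrable.of_bound ((hwm n).pow_const 2).aestronglyMeasurable ((1 / q) ^ 2)
      (Filter.Eventually.of_forall fun δ => by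
        rw [norm_pow]
        exact pow_le_pow_left₀ (norm_nonneg _) (hwb n δ) 2)
  have hw0 : ∀ n, ∫ δ in I, w n δ = 0 := by
    intro n
    have hsub := intervalIntegral.integral_comp_mul_left (a := 0) (b := q⁻¹)
      (fun z => (addShift p (c n) z - 1 / 2) / q) hq0.ne'
    rw [hI, integral_Ico_eq_integral_Ioc,
      ← intervalIntegral.integral_of_le (by positivity), hsub, mul_zero,
      mul_inv_cancel₀ hq0.ne', intervalIntegral.integral_div,
      intervalIntegral.integral_sub (intervalIntegrable_addShift hp2 _ _ _) (by simp),
      integral_addShift hp2 (hc n)]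
    simp
  have hpt : ∀ δ ∈ I,
      sqErr 1 N (fun _ => γ₁) (fun n _ => pshift p (radInv p n.val) (a / q + δ))
        = sqErr 1 N (fun _ => γ₁) (fun n _ => b n)
          + γ₁ / N * ∑ n, (2 * b n * w n δ + w n δ ^ 2)
          - γ₁ / (N : ℝ) ^ 2 * ∑ n, ∑ h, w (if b n < b h then h else n) δ := by
    intro δ hδ
    have hz0 : 0 ≤ q * δ := mul_nonneg hq0.le hδ.1
    have hz1 : q * δ < 1 := by
      have := mul_lt_mul_of_pos_left hδ.2 hq0
      rwa [mul_inv_cancel₀ hq0.ne'] at this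
    have hsh : (fun (n : Fin N) (_ : Fin 1) => pshift p (radInv p n.val) (a / q + δ))
        = fun n _ => b n + w n δ := by
      funext n _
      have h := (hform n (hn n)).2 (q * δ) hz0 hz1
      rw [show ((a : ℝ) + q * δ) / q = a / q + δ by field_simp] at h
      rw [h]
      simp only [hb, hw, hA, hcdef]
      ring
    rw [hsh]
    refine sqErr_one_perturb hN γ₁ b (fun n => w n δ) hbinj fun n h hlt => ?_
    have hlt' : ((A n + 1 : ℕ) : ℝ) ≤ A h := by
      simp only [hb] at hlt
      rw [div_lt_div_iff_of_pos_right hq0] at hlt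
      have : (A n : ℝ) < A h := by linarith
      exact_mod_cast this
    push_cast at hlt'
    simp only [hb, hw]
    rw [← add_div, ← add_div]
    refine div_le_div_of_nonneg_right ?_ hq0.le
    linarith [addShift_le_one hp2 (c n) (q * δ), addShift_nonneg p (c h) (q * δ)]
  have hi1 : ∀ n, Integrable (fun δ => 2 * b n * w n δ + w n δ ^ 2) (volume.restrict I) :=
    fun n => ((hwi n).const_mul _).add (hw2i n)
  have hi2 : Integrable (fun δ => γ₁ / N * ∑ n, (2 * b n * w n δ + w n δ ^ 2))
      (volume.restrict I) :=
    (integrable_finsetSum _ fun n _ => hi1 n).const_mul _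
  have hi3 : ∀ n, Integrable (fun δ => ∑ h, w (if b n < b h then h else n) δ)
      (volume.restrict I) := fun n => integrable_finsetSum _ fun h _ => hwi _
  have hi4 : Integrable (fun δ => γ₁ / (N : ℝ) ^ 2 *
      ∑ n, ∑ h, w (if b n < b h then h else n) δ) (volume.restrict I) :=
    (integrable_finsetSum _ fun n _ => hi3 n).const_mul _
  have hi0 : Integrable (fun _ : ℝ => sqErr 1 N (fun _ => γ₁) (fun n _ => b n))
      (volume.restrict I) := integrable_const _
  have hz : ∫ δ in I, γ₁ / (N : ℝ) ^ 2 * ∑ n, ∑ h, w (if b n < b h then h else n) δ = 0 := by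
    rw [integral_const_mul, integral_finsetSum _ fun n _ => hi3 n]
    simp_rw [integral_finsetSum _ fun h _ => hwi _, hw0]
    simp
  have hpos : 0 ≤ ∫ δ in I, γ₁ / N * ∑ n, (2 * b n * w n δ + w n δ ^ 2) := by
    rw [integral_const_mul, integral_finsetSum _ fun n _ => hi1 n]
    refine mul_nonneg (by positivity) (sum_nonneg fun n _ => ?_)
    rw [integral_add ((hwi n).const_mul _) (hw2i n), integral_const_mul, hw0, mul_zero, zero_add]
    exact integral_nonneg fun δ => sq_nonneg _
  have hvol : volume.real I = q⁻¹ := by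
    rw [hI, Real.volume_real_Ico_of_le (by positivity), sub_zero]
  have hsplit := integral_sub (hi0.add hi2) hi4
  simp only [Pi.add_apply] at hsplit
  rw [integral_add hi0 hi2] at hsplit
  rw [hmid, setIntegral_congr_fun measurableSet_Ico hpt, ← hI, hsplit, hz, sub_zero, setIntegral_const, hvol, smul_eq_mul, mul_add,
    mul_inv_cancel_left₀ hq0.ne']
  exact le_add_of_nonneg_right (mul_nonneg hq0.le hpos)
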